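/- Let Ω, Ω' ⊆ ℝ² be open and let f : Ω' → Ω be a C² bijection such that, for some κ ≥ 1, the Jacobian matrix J_f satisfies ‖J_f(x)‖ ≤ κ and det J_f(x) > 0 for all x ∈ Ω', and the inverse map f⁻¹ is differentiable with ‖J_{f⁻¹}(y)‖ ≤ κ for all y ∈ Ω, where ‖·‖ is the operator norm. If u ∈ L¹(Ω) with Var(u; Ω) < ∞, then u∘f ∈ L¹(Ω'), Var(u∘f; Ω') < ∞, and κ⁻¹·Var(u; Ω) ≤ Var(u∘f; Ω') ≤ κ·Var(u; Ω). -/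

import Mathlib

open MeasureTheory
open scoped ENNReal

/-- Divergence of a vector field `v : ℝ² → ℝ²`: `div v = ∂₁v₁ + ∂₂v₂`. -/
noncomputable def divergence (v : EuclideanSpace ℝ (Fin 2) → EuclideanSpace ℝ (Fin 2))
    (x : EuclideanSpace ℝ (Fin 2)) : ℝ :=
  ∑ i : Fin 2, fderiv ℝ v x (EuclideanSpace.single i 1) i

/-- Total variation `Var(u; U)` of `u` on an open set `U`, defined by duality against
smooth compactly supported vector fields valued in the unit ball. -/
noncomputable def totalVariation (u : EuclideanSpace ℝ (Fin 2) → ℝ)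
    (U : Set (EuclideanSpace ℝ (Fin 2))) : ℝ≥0∞ :=
  ⨆ v : {v : EuclideanSpace ℝ (Fin 2) → EuclideanSpace ℝ (Fin 2) //
      ContDiff ℝ (⊤ : ℕ∞) v ∧ HasCompactSupport v ∧ tsupport v ⊆ U ∧ ∀ x, ‖v x‖ ≤ 1},
    ENNReal.ofReal (∫ x in U, u x * divergence v.1 x)

open scoped Convolution in
theorem tv_mollify (Ω : Set (EuclideanSpace ℝ (Fin 2))) (hΩ : IsOpen Ω)
    (w : EuclideanSpace ℝ (Fin 2) → EuclideanSpace ℝ (Fin 2))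
    (hw : ContDiff ℝ 1 w) (hc : HasCompactSupport w) (hs : tsupport w ⊆ Ω)
    (κ : ℝ) (hb : ∀ x, ‖w x‖ ≤ κ) (ε : ℝ) (hε : 0 < ε) :
    ∃ w' : EuclideanSpace ℝ (Fin 2) → EuclideanSpace ℝ (Fin 2),
      ContDiff ℝ (⊤ : ℕ∞) w' ∧ HasCompactSupport w' ∧ tsupport w' ⊆ Ω ∧ (∀ x, ‖w' x‖ ≤ κ) ∧
      ∀ x, ‖fderiv ℝ w' x - fderiv ℝ w x‖ ≤ ε := by
  have hκ : 0 ≤ κ := (norm_nonneg _).trans (hb 0)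
  obtain ⟨δ₁, hδ₁, h₁⟩ := hc.isCompact.exists_cthickening_subset_open hΩ hs
  have hcd : Continuous (fderiv ℝ w) := hw.continuous_fderiv one_ne_zero
  have huc : UniformContinuous (fderiv ℝ w) :=
    (hc.fderiv ℝ).uniformContinuous_of_continuous hcd
  obtain ⟨δ₂, hδ₂, h₂⟩ := Metric.uniformContinuous_iff.1 huc ε hε
  set δ := min δ₁ δ₂ with hδ
  have hδ0 : 0 < δ := lt_min hδ₁ hδ₂
  let φ : ContDiffBump (0 : EuclideanSpace ℝ (Fin 2)) := ⟨δ / 2, δ, by positivity, by linarith⟩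
  let p := φ.normed volume
  have hp : LocallyIntegrable p volume := φ.continuous_normed.locallyIntegrable
  refine ⟨p ⋆[ContinuousLinearMap.lsmul ℝ ℝ, volume] w, ?_, ?_, ?_, ?_, ?_⟩
  · exact φ.hasCompactSupport_normed.contDiff_convolution_left _ φ.contDiff_normed
      hw.continuous.locallyIntegrable
  · exact φ.hasCompactSupport_normed.convolution _ hc
  · refine Set.Subset.trans ?_ h₁
    refine closure_minimal ?_ Metric.isClosed_cthickening
    refine (support_convolution_subset_swap _).trans ?_
    rintro _ ⟨a, ha, b, hb, rfl⟩
    rw [φ.support_normed_eq] at hb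
    have hb' : ‖b‖ < δ := by simpa using hb
    refine Metric.mem_cthickening_of_dist_le _ a _ _ (subset_tsupport _ ha) ?_
    simp only [dist_self_add_left]
    exact hb'.le.trans (min_le_left _ _)
  · intro x
    have := dist_convolution_le (μ := volume) (g := w) (x₀ := x) (z₀ := 0) hκ
      φ.support_normed_eq.subset φ.nonneg_normed φ.integral_normed
      hw.continuous.aestronglyMeasurable (fun y _ => by simpa using hb y)
    simpa using this
  · intro x
    rw [(hc.hasFDerivAt_convolution_right (ContinuousLinearMap.lsmul ℝ ℝ) hp hw x).fderiv,
      ← dist_eq_norm]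
    have := φ.dist_normed_convolution_le (μ := volume) (g := fderiv ℝ w) (x₀ := x) (ε := ε)
      hcd.aestronglyMeasurable (fun y hy => (h₂ (lt_of_lt_of_le hy (min_le_right _ _))).le)
    exact this

theorem tv_div_diff (w w' : EuclideanSpace ℝ (Fin 2) → EuclideanSpace ℝ (Fin 2)) (x ) (ε : ℝ)
    (h : ‖fderiv ℝ w' x - fderiv ℝ w x‖ ≤ ε) : |divergence w' x - divergence w x| ≤ 2 * ε := by
  have key : ∀ i : Fin 2, |(fderiv ℝ w' x - fderiv ℝ w x) (EuclideanSpace.single i 1) i| ≤ ε := by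
    intro i
    refine (PiLp.norm_apply_le _ i).trans (((fderiv ℝ w' x - fderiv ℝ w x).le_opNorm _).trans ?_)
    simpa using h
  have h0 := abs_le.1 (key 0)
  have h1 := abs_le.1 (key 1)
  simp only [divergence, Fin.sum_univ_two]
  simp only [_root_.sub_apply, PiLp.sub_apply] at h0 h1
  rw [abs_le]
  constructor <;> linarith

theorem tv_div_cont (w : EuclideanSpace ℝ (Fin 2) → EuclideanSpace ℝ (Fin 2))
    (hw : ContDiff ℝ 1 w) : Continuous (divergence w) := by
  have hcd : Continuous (fderiv ℝ w) := hw.continuous_fderiv one_ne_zero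
  unfold divergence
  fun_prop

theorem tv_div_int (Ω : Set (EuclideanSpace ℝ (Fin 2)))
    (u : EuclideanSpace ℝ (Fin 2) → ℝ) (hu : IntegrableOn u Ω)
    (w : EuclideanSpace ℝ (Fin 2) → EuclideanSpace ℝ (Fin 2))
    (hw : ContDiff ℝ 1 w) (hc : HasCompactSupport w) :
    IntegrableOn (fun x => u x * divergence w x) Ω := by
  have hcd : Continuous (fderiv ℝ w) := hw.continuous_fderiv one_ne_zero
  obtain ⟨C, hC⟩ := (hc.fderiv ℝ).exists_bound_of_continuous hcd
  refine Integrable.mul_bdd (c := 2 * C) hu (tv_div_cont w hw).aestronglyMeasurable ?_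
  refine Filter.Eventually.of_forall fun x => ?_
  have := tv_div_diff (fun _ => 0) w x C (by simpa using hC x)
  simpa [divergence] using this

theorem tv_le (Ω : Set (EuclideanSpace ℝ (Fin 2))) (hΩ : IsOpen Ω)
    (u : EuclideanSpace ℝ (Fin 2) → ℝ) (hu : IntegrableOn u Ω)
    (w : EuclideanSpace ℝ (Fin 2) → EuclideanSpace ℝ (Fin 2))
    (hw : ContDiff ℝ 1 w) (hc : HasCompactSupport w) (hs : tsupport w ⊆ Ω)
    (κ : ℝ) (hκ : 0 < κ) (hb : ∀ x, ‖w x‖ ≤ κ) :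
    ENNReal.ofReal (∫ x in Ω, u x * divergence w x) ≤ ENNReal.ofReal κ * totalVariation u Ω := by
  by_cases hV : totalVariation u Ω = ⊤
  · rw [hV, ENNReal.mul_top (by simpa using hκ)]; exact le_top
  rw [← ENNReal.ofReal_toReal hV, ← ENNReal.ofReal_mul hκ.le]
  apply ENNReal.ofReal_le_ofReal
  set V := (totalVariation u Ω).toReal
  set I := ∫ x in Ω, |u x|
  have hI : 0 ≤ I := integral_nonneg fun _ => abs_nonneg _
  apply le_of_forall_pos_le_add
  intro η hη
  set ε := η / (2 * I + 1)
  have hε : 0 < ε := by positivity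
  obtain ⟨w', h1, h2, h3, h4, h5⟩ := tv_mollify Ω hΩ w hw hc hs κ hb ε hε
  have hw'1 : ContDiff ℝ 1 w' := h1.of_le (by exact_mod_cast le_top)
  have hi := tv_div_int Ω u hu w hw hc
  have hi' := tv_div_int Ω u hu w' hw'1 h2
  have A : ∫ x in Ω, u x * divergence w' x ≤ κ * V := by
    have hd : ∀ x, divergence (fun y => κ⁻¹ • w' y) x = κ⁻¹ * divergence w' x := by
      intro x
      have : fderiv ℝ (fun y => κ⁻¹ • w' y) x = κ⁻¹ • fderiv ℝ w' x :=
        fderiv_fun_const_smul (hw'1.differentiable one_ne_zero x) _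
      simp [divergence, this, mul_add]
    have hle : ENNReal.ofReal (∫ x in Ω, u x * divergence (fun y => κ⁻¹ • w' y) x)
        ≤ totalVariation u Ω := by
      refine le_iSup (fun v : {v : EuclideanSpace ℝ (Fin 2) → EuclideanSpace ℝ (Fin 2) //
        ContDiff ℝ (⊤ : ℕ∞) v ∧ HasCompactSupport v ∧ tsupport v ⊆ Ω ∧ ∀ x, ‖v x‖ ≤ 1} =>
          ENNReal.ofReal (∫ x in Ω, u x * divergence v.1 x))
        ⟨fun y => κ⁻¹ • w' y, contDiff_const.fun_smul h1, h2.smul_left (f := fun _ => κ⁻¹),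
          (tsupport_smul_subset_right (fun _ => κ⁻¹) w').trans h3, fun x => ?_⟩
      rw [norm_smul, norm_inv, Real.norm_of_nonneg hκ.le, inv_mul_le_iff₀ hκ]
      simpa using h4 x
    rw [← ENNReal.ofReal_toReal hV, ENNReal.ofReal_le_ofReal_iff ENNReal.toReal_nonneg] at hle
    simp only [hd, mul_left_comm _ κ⁻¹, integral_const_mul] at hle
    rwa [inv_mul_le_iff₀ hκ] at hle
  have B : ∫ x in Ω, u x * divergence w x ≤
      (∫ x in Ω, u x * divergence w' x) + 2 * ε * I := by
    rw [← integral_const_mul, ← integral_add hi' (hu.abs.const_mul _)]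
    refine integral_mono hi (hi'.add (hu.abs.const_mul _)) fun x => ?_
    have := tv_div_diff w w' x ε (h5 x)
    have h6 : |u x * (divergence w' x - divergence w x)| ≤ |u x| * (2 * ε) := by
      rw [abs_mul]; gcongr
    have := neg_abs_le (u x * (divergence w' x - divergence w x))
    beta_reduce
    linarith
  have C : 2 * ε * I ≤ η := by
    have : ε * (2 * I + 1) = η := by simp only [ε]; field_simp
    linarith
  linarith

/-- adjugate action -/
noncomputable def tvAdj (A : EuclideanSpace ℝ (Fin 2) →L[ℝ] EuclideanSpace ℝ (Fin 2))
    (p : EuclideanSpace ℝ (Fin 2)) : EuclideanSpace ℝ (Fin 2) :=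
  !₂[A (EuclideanSpace.single 1 1) 1 * p 0 - A (EuclideanSpace.single 1 1) 0 * p 1,
    A (EuclideanSpace.single 0 1) 0 * p 1 - A (EuclideanSpace.single 0 1) 1 * p 0]

theorem tv_decomp (h : EuclideanSpace ℝ (Fin 2)) :
    h = h 0 • EuclideanSpace.single 0 1 + h 1 • EuclideanSpace.single 1 1 := by
  ext i; fin_cases i <;> simp

theorem tv_map (A : EuclideanSpace ℝ (Fin 2) →L[ℝ] EuclideanSpace ℝ (Fin 2))
    (h : EuclideanSpace ℝ (Fin 2)) (i : Fin 2) :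
    A h i = h 0 * A (EuclideanSpace.single 0 1) i + h 1 * A (EuclideanSpace.single 1 1) i := by
  conv_lhs => rw [tv_decomp h]
  simp

theorem tvAdj_norm (A : EuclideanSpace ℝ (Fin 2) →L[ℝ] EuclideanSpace ℝ (Fin 2))
    (p : EuclideanSpace ℝ (Fin 2)) : ‖tvAdj A p‖ ≤ ‖A‖ * ‖p‖ := by
  set z : EuclideanSpace ℝ (Fin 2) := !₂[tvAdj A p 1, - tvAdj A p 0] with hz
  set q : EuclideanSpace ℝ (Fin 2) := !₂[p 1, - p 0] with hq
  have hzn : ‖z‖ = ‖tvAdj A p‖ := by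
    simp [EuclideanSpace.norm_eq, hz, Fin.sum_univ_two, add_comm]
  have hqn : ‖q‖ = ‖p‖ := by
    simp [EuclideanSpace.norm_eq, hq, Fin.sum_univ_two, add_comm]
  have h1 : inner ℝ z z = inner ℝ q (A z) := by
    simp only [PiLp.inner_apply, Fin.sum_univ_two, tv_map A z]
    simp [hz, hq, tvAdj]
    ring
  have h2 : ‖z‖ * ‖z‖ ≤ ‖q‖ * (‖A‖ * ‖z‖) := by
    rw [← real_inner_self_eq_norm_mul_norm, h1]
    exact (real_inner_le_norm _ _).trans (by gcongr; exact A.le_opNorm z)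
  rw [← hzn, ← hqn]
  rcases (norm_nonneg z).eq_or_lt with h | h
  · rw [← h]; positivity
  · nlinarith

theorem tv_det (A : EuclideanSpace ℝ (Fin 2) →L[ℝ] EuclideanSpace ℝ (Fin 2)) :
    A.det = A (EuclideanSpace.single 0 1) 0 * A (EuclideanSpace.single 1 1) 1
      - A (EuclideanSpace.single 1 1) 0 * A (EuclideanSpace.single 0 1) 1 := by
  rw [ContinuousLinearMap.det, ← LinearMap.det_toMatrix (EuclideanSpace.basisFun (Fin 2) ℝ).toBasis,
    Matrix.det_fin_two]
  simp [LinearMap.toMatrix_apply]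

theorem tv_piola (g v : EuclideanSpace ℝ (Fin 2) → EuclideanSpace ℝ (Fin 2))
    (y : EuclideanSpace ℝ (Fin 2)) (hg : ContDiffAt ℝ 2 g y) (hv : ContDiff ℝ 1 v) :
    divergence (fun x => tvAdj (fderiv ℝ g x) (v (g x))) y =
      (fderiv ℝ g y).det * divergence v (g y) := by
  have hg1 : DifferentiableAt ℝ g y := hg.differentiableAt two_ne_zero
  have hg2 : DifferentiableAt ℝ (fderiv ℝ g) y :=
    (hg.fderiv_right (m := 1) (by norm_num)).differentiableAt one_ne_zero
  have hsym : IsSymmSndFDerivAt ℝ g y := hg.isSymmSndFDerivAt (by simp)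
  have hL := hg2.hasFDerivAt
  set L := fderiv ℝ (fderiv ℝ g) y with hLdef
  have hV : HasFDerivAt (fun x => v (g x)) ((fderiv ℝ v (g y)).comp (fderiv ℝ g y)) y :=
    (hv.differentiable one_ne_zero (g y)).hasFDerivAt.comp y hg1.hasFDerivAt
  set B := fderiv ℝ v (g y)
  set A := fderiv ℝ g y with hA
  have hs := hsym (EuclideanSpace.single 0 1) (EuclideanSpace.single 1 1)
  rw [← hLdef] at hs
  have pr : ∀ i : Fin 2, ∀ (F : EuclideanSpace ℝ (Fin 2) → EuclideanSpace ℝ (Fin 2)) F',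
      HasFDerivAt F F' y → HasFDerivAt (fun x => F x i)
        ((EuclideanSpace.proj i : EuclideanSpace ℝ (Fin 2) →L[ℝ] ℝ).comp F') y :=
    fun i F F' h => (EuclideanSpace.proj i : EuclideanSpace ℝ (Fin 2) →L[ℝ] ℝ).hasFDerivAt.comp y h
  have hD : ∀ e : EuclideanSpace ℝ (Fin 2),
      HasFDerivAt (fun x => fderiv ℝ g x e) (L.flip e) y := fun e => by
    have := hL.clm_apply (hasFDerivAt_const e y)
    simpa using this
  have h0 := ((pr 1 _ _ (hD (EuclideanSpace.single 1 1))).mul (pr 0 _ _ hV)).sub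
    ((pr 0 _ _ (hD (EuclideanSpace.single 1 1))).mul (pr 1 _ _ hV))
  have h1 := ((pr 0 _ _ (hD (EuclideanSpace.single 0 1))).mul (pr 1 _ _ hV)).sub
    ((pr 1 _ _ (hD (EuclideanSpace.single 0 1))).mul (pr 0 _ _ hV))
  have hW : DifferentiableAt ℝ (fun x => tvAdj (fderiv ℝ g x) (v (g x))) y := by
    rw [differentiableAt_piLp]
    intro i
    fin_cases i
    · exact h0.differentiableAt
    · exact h1.differentiableAt
  have e0 := (pr 0 _ _ hW.hasFDerivAt).unique h0
  have e1 := (pr 1 _ _ hW.hasFDerivAt).unique h1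
  have e0' := congrArg (fun T => T (EuclideanSpace.single 0 1)) e0
  have e1' := congrArg (fun T => T (EuclideanSpace.single 1 1)) e1
  simp at e0' e1'
  rw [divergence, Fin.sum_univ_two, e0', e1', tv_det, divergence, Fin.sum_univ_two]
  simp only [tv_map B (A _), hs, ← hA]
  ring

theorem tv_half (Ω Ω' : Set (EuclideanSpace ℝ (Fin 2))) (hΩ : IsOpen Ω)
    (f g : EuclideanSpace ℝ (Fin 2) → EuclideanSpace ℝ (Fin 2))
    (hf : ContinuousOn f Ω') (hfm : Set.MapsTo f Ω' Ω)
    (hgf : ∀ x ∈ Ω', g (f x) = x) (hfg : ∀ y ∈ Ω, f (g y) = y)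
    (hgbij : Set.BijOn g Ω Ω') (hg : ContDiffOn ℝ 2 g Ω)
    (hdet : ∀ y ∈ Ω, 0 < (fderiv ℝ g y).det)
    (κ : ℝ) (hκ : 0 < κ) (hJg : ∀ y ∈ Ω, ‖fderiv ℝ g y‖ ≤ κ)
    (u : EuclideanSpace ℝ (Fin 2) → ℝ) (hu : IntegrableOn u Ω) :
    totalVariation (u ∘ f) Ω' ≤ ENNReal.ofReal κ * totalVariation u Ω := by
  refine iSup_le ?_
  rintro ⟨v, hv, hvc, hvs, hvb⟩
  have hv1 : ContDiff ℝ 1 v := hv.of_le (by exact_mod_cast le_top)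
  have hgat : ∀ y ∈ Ω, ContDiffAt ℝ 2 g y := fun y hy => hg.contDiffAt (hΩ.mem_nhds hy)
  set w0 : EuclideanSpace ℝ (Fin 2) → EuclideanSpace ℝ (Fin 2) :=
    fun x => tvAdj (fderiv ℝ g x) (v (g x)) with hw0
  set w := Ω.indicator w0 with hwdef
  set K := f '' tsupport v with hK
  have hKc : IsCompact K := hvc.isCompact.image_of_continuousOn (hf.mono hvs)
  have hKΩ : K ⊆ Ω := by
    rintro _ ⟨x, hx, rfl⟩
    exact hfm (hvs hx)
  have hw_out : ∀ y ∉ K, w y = 0 := by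
    intro y hy
    by_cases hyΩ : y ∈ Ω
    · have : v (g y) = 0 := by
        by_contra hne
        exact hy ⟨g y, subset_tsupport _ hne, hfg y hyΩ⟩
      rw [hwdef, Set.indicator_of_mem hyΩ, hw0]
      ext i
      fin_cases i <;> simp [tvAdj, this]
    · exact Set.indicator_of_notMem hyΩ _
  have hsupp : tsupport w ⊆ K :=
    closure_minimal (fun y hy => by_contra fun h => hy (hw_out y h)) hKc.isClosed
  have hcomp : HasCompactSupport w := HasCompactSupport.intro hKc hw_out
  have heq : ∀ y ∈ Ω, w =ᶠ[nhds y] w0 := fun y hy =>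
    Filter.eventually_of_mem (hΩ.mem_nhds hy) fun x hx => Set.indicator_of_mem hx _
  have hw : ContDiff ℝ 1 w := by
    rw [contDiff_iff_contDiffAt]
    intro y
    by_cases hy : y ∈ Ω
    · refine ContDiffAt.congr_of_eventuallyEq ?_ (heq y hy)
      have hD : ContDiffAt ℝ 1 (fderiv ℝ g) y := (hgat y hy).fderiv_right (by norm_num)
      have hV : ContDiffAt ℝ 1 (fun x => v (g x)) y :=
        hv1.contDiffAt.comp y ((hgat y hy).of_le (by norm_num))
      have hDc : ∀ (e : EuclideanSpace ℝ (Fin 2)) (i : Fin 2),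
          ContDiffAt ℝ 1 (fun x => fderiv ℝ g x e i) y := fun e i =>
        (contDiffAt_piLp 2).1 (hD.clm_apply contDiffAt_const) i
      have hVc : ∀ (i : Fin 2), ContDiffAt ℝ 1 (fun x => v (g x) i) y := fun i =>
        (contDiffAt_piLp 2).1 hV i
      rw [contDiffAt_piLp]
      intro i
      fin_cases i
      · exact ((hDc _ 1).mul (hVc 0)).sub ((hDc _ 0).mul (hVc 1))
      · exact ((hDc _ 0).mul (hVc 1)).sub ((hDc _ 1).mul (hVc 0))
    · have : w =ᶠ[nhds y] fun _ => 0 :=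
        Filter.eventually_of_mem (hKc.isClosed.isOpen_compl.mem_nhds fun h => hy (hKΩ h))
          fun x hx => hw_out x hx
      exact contDiffAt_const.congr_of_eventuallyEq this
  have hwb : ∀ x, ‖w x‖ ≤ κ := by
    intro x
    by_cases hx : x ∈ Ω
    · rw [hwdef, Set.indicator_of_mem hx]
      calc _ ≤ ‖fderiv ℝ g x‖ * ‖v (g x)‖ := tvAdj_norm _ _
        _ ≤ κ * 1 := by gcongr; exacts [hJg x hx, hvb _]
        _ = κ := mul_one κ
    · rw [hwdef, Set.indicator_of_notMem hx]; simpa using hκ.le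
  have hint : ∫ x in Ω', (u ∘ f) x * divergence v x = ∫ y in Ω, u y * divergence w y := by
    rw [← hgbij.image_eq, integral_image_eq_integral_abs_det_fderiv_smul volume hΩ.measurableSet
      (fun y hy => ((hgat y hy).differentiableAt two_ne_zero).hasFDerivAt.hasFDerivWithinAt)
      hgbij.injOn]
    refine setIntegral_congr_fun hΩ.measurableSet fun y hy => ?_
    have h1 : divergence w y = divergence w0 y := by
      simp only [divergence, (heq y hy).fderiv_eq]
    simp only [Function.comp, hfg y hy, smul_eq_mul, abs_of_pos (hdet y hy), h1]
    rw [hw0, tv_piola g v y (hgat y hy) hv1]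
    ring
  change ENNReal.ofReal (∫ x in Ω', (u ∘ f) x * divergence v x) ≤ _
  rw [hint]
  exact tv_le Ω hΩ u hu w hw hcomp (hsupp.trans hKΩ) κ hκ hwb

/-- BV composition lemma: if `f : Ω' → Ω` is a `C²` bijection with
`‖J_f‖ ≤ κ`, `det J_f > 0` and `‖J_{f⁻¹}‖ ≤ κ`, and `u ∈ L¹(Ω)` has finite total
variation, then `u ∘ f ∈ L¹(Ω')` has finite total variation and
`κ⁻¹ Var(u;Ω) ≤ Var(u∘f;Ω') ≤ κ Var(u;Ω)`. -/
theorem stmt6 (Ω Ω' : Set (EuclideanSpace ℝ (Fin 2))) (hΩ : IsOpen Ω) (hΩ' : IsOpen Ω')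
    (f : EuclideanSpace ℝ (Fin 2) → EuclideanSpace ℝ (Fin 2))
    (hf : ContDiffOn ℝ 2 f Ω') (hbij : Set.BijOn f Ω' Ω)
    (κ : ℝ) (hκ : 1 ≤ κ)
    (hJf : ∀ x ∈ Ω', ‖fderiv ℝ f x‖ ≤ κ)
    (hdet : ∀ x ∈ Ω', 0 < LinearMap.det ((fderiv ℝ f x :
      EuclideanSpace ℝ (Fin 2) →ₗ[ℝ] EuclideanSpace ℝ (Fin 2))))
    (g : EuclideanSpace ℝ (Fin 2) → EuclideanSpace ℝ (Fin 2))
    (hginv : ∀ x ∈ Ω', g (f x) = x) (hgbij : Set.BijOn g Ω Ω')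
    (hgdiff : ∀ y ∈ Ω, DifferentiableAt ℝ g y)
    (hJg : ∀ y ∈ Ω, ‖fderiv ℝ g y‖ ≤ κ)
    (u : EuclideanSpace ℝ (Fin 2) → ℝ) (hu : IntegrableOn u Ω)
    (hVar : totalVariation u Ω ≠ ⊤) :
    IntegrableOn (u ∘ f) Ω' ∧ totalVariation (u ∘ f) Ω' ≠ ⊤ ∧
      ENNReal.ofReal κ⁻¹ * totalVariation u Ω ≤ totalVariation (u ∘ f) Ω' ∧
      totalVariation (u ∘ f) Ω' ≤ ENNReal.ofReal κ * totalVariation u Ω := by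
  have hκ0 : 0 < κ := by linarith
  have hfg : ∀ y ∈ Ω, f (g y) = y := by
    intro y hy
    obtain ⟨x, hx, rfl⟩ := hbij.surjOn hy
    rw [hginv x hx]
  have hfat : ∀ x ∈ Ω', ContDiffAt ℝ 2 f x := fun x hx => hf.contDiffAt (hΩ'.mem_nhds hx)
  have hfd : ∀ x ∈ Ω', HasFDerivAt f (fderiv ℝ f x) x := fun x hx =>
    ((hfat x hx).differentiableAt two_ne_zero).hasFDerivAt
  have hgd : ∀ y ∈ Ω, HasFDerivAt g (fderiv ℝ g y) y := fun y hy => (hgdiff y hy).hasFDerivAt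
  have hc1 : ∀ y ∈ Ω, (fderiv ℝ f (g y)).comp (fderiv ℝ g y) =
      ContinuousLinearMap.id ℝ (EuclideanSpace ℝ (Fin 2)) := by
    intro y hy
    have h1 := (hfd (g y) (hgbij.mapsTo hy)).comp y (hgd y hy)
    have h2 : HasFDerivAt (f ∘ g) (ContinuousLinearMap.id ℝ (EuclideanSpace ℝ (Fin 2))) y :=
      (hasFDerivAt_id y).congr_of_eventuallyEq
        (Filter.eventually_of_mem (hΩ.mem_nhds hy) fun z hz => hfg z hz)
    exact h1.unique h2
  have hc2 : ∀ y ∈ Ω, (fderiv ℝ g y).comp (fderiv ℝ f (g y)) =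
      ContinuousLinearMap.id ℝ (EuclideanSpace ℝ (Fin 2)) := by
    intro y hy
    have hx := hgbij.mapsTo hy
    have h0 := hgd y hy
    have h1 : HasFDerivAt (g ∘ f) ((fderiv ℝ g y).comp (fderiv ℝ f (g y))) (g y) := by
      refine HasFDerivAt.comp (g y) ?_ (hfd (g y) hx)
      rwa [hfg y hy]
    have h2 : HasFDerivAt (g ∘ f) (ContinuousLinearMap.id ℝ (EuclideanSpace ℝ (Fin 2))) (g y) :=
      (hasFDerivAt_id _).congr_of_eventuallyEq
        (Filter.eventually_of_mem (hΩ'.mem_nhds hx) fun z hz => hginv z hz)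
    exact h1.unique h2
  let Φ : OpenPartialHomeomorph (EuclideanSpace ℝ (Fin 2)) (EuclideanSpace ℝ (Fin 2)) :=
    { toFun := f
      invFun := g
      source := Ω'
      target := Ω
      map_source' := fun x hx => hbij.mapsTo hx
      map_target' := fun y hy => hgbij.mapsTo hy
      left_inv' := hginv
      right_inv' := hfg
      open_source := hΩ'
      open_target := hΩ
      continuousOn_toFun := hf.continuousOn
      continuousOn_invFun := fun y hy => (hgdiff y hy).continuousAt.continuousWithinAt }
  have hg2 : ContDiffOn ℝ 2 g Ω := by
    intro y hy
    have hx := hgbij.mapsTo hy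
    have := Φ.contDiffAt_symm (n := 2) (a := y)
      (f₀' := ContinuousLinearEquiv.equivOfInverse (fderiv ℝ f (g y)) (fderiv ℝ g y)
        (fun z => congrArg (fun T => T z) (hc2 y hy))
        (fun z => congrArg (fun T => T z) (hc1 y hy))) hy (hfd (g y) hx) (hfat (g y) hx)
    exact ContDiffAt.contDiffWithinAt this
  have hdetg : ∀ y ∈ Ω, 0 < (fderiv ℝ g y).det := by
    intro y hy
    have h1 : (fderiv ℝ f (g y)).det * (fderiv ℝ g y).det = 1 := by
      have := congrArg (fun T : EuclideanSpace ℝ (Fin 2) →L[ℝ] EuclideanSpace ℝ (Fin 2) =>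
        LinearMap.det (T : EuclideanSpace ℝ (Fin 2) →ₗ[ℝ] EuclideanSpace ℝ (Fin 2))) (hc1 y hy)
      simpa [ContinuousLinearMap.det, LinearMap.det_comp] using this
    have h2 : 0 < (fderiv ℝ f (g y)).det := hdet _ (hgbij.mapsTo hy)
    exact pos_of_mul_pos_right (by rw [h1]; exact one_pos) h2.le
  have hui : IntegrableOn (u ∘ f) Ω' := by
    rw [← hgbij.image_eq, integrableOn_image_iff_integrableOn_abs_det_fderiv_smul volume
      hΩ.measurableSet (fun y hy => (hgd y hy).hasFDerivWithinAt) hgbij.injOn]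
    have hcont : ContinuousOn (fun y => |(fderiv ℝ g y).det|) Ω := by
      have h1 : ContinuousOn (fderiv ℝ g) Ω :=
        hg2.continuousOn_fderiv_of_isOpen hΩ (by norm_num)
      simp only [tv_det]
      fun_prop
    have hb : ∀ y ∈ Ω, |(fderiv ℝ g y).det| ≤ 2 * κ ^ 2 := by
      intro y hy
      have hk : ∀ i j : Fin 2, |fderiv ℝ g y (EuclideanSpace.single i 1) j| ≤ κ := by
        intro i j
        refine (PiLp.norm_apply_le _ j).trans (((fderiv ℝ g y).le_opNorm _).trans ?_)
        simpa using hJg y hy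
      rw [tv_det]
      refine (abs_sub _ _).trans ?_
      rw [abs_mul, abs_mul]
      have a1 := mul_le_mul (hk 0 0) (hk 1 1) (abs_nonneg _) hκ0.le
      have a2 := mul_le_mul (hk 1 0) (hk 0 1) (abs_nonneg _) hκ0.le
      nlinarith
    have h2 : IntegrableOn (fun y => |(fderiv ℝ g y).det| * u y) Ω := by
      refine Integrable.bdd_mul (c := 2 * κ ^ 2) hu
        (hcont.aestronglyMeasurable hΩ.measurableSet) ?_
      refine (ae_restrict_mem hΩ.measurableSet).mono fun y hy => ?_
      simpa using hb y hy
    refine h2.congr_fun (fun y hy => ?_) hΩ.measurableSet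
    simp [hfg y hy]
  have hup := tv_half Ω Ω' hΩ f g hf.continuousOn hbij.mapsTo hginv hfg hgbij hg2 hdetg κ hκ0 hJg
    u hu
  have hlo := tv_half Ω' Ω hΩ' g f hg2.continuousOn hgbij.mapsTo hfg hginv hbij hf
    (fun x hx => hdet x hx) κ hκ0 hJf (u ∘ f) hui
  have hcongr : totalVariation ((u ∘ f) ∘ g) Ω = totalVariation u Ω := by
    unfold totalVariation
    congr 1
    ext v
    congr 1
    refine setIntegral_congr_fun hΩ.measurableSet fun y hy => ?_
    simp [hfg y hy]
  rw [hcongr] at hlo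
  refine ⟨hui, ne_top_of_le_ne_top (ENNReal.mul_ne_top ENNReal.ofReal_ne_top hVar) hup, ?_, hup⟩
  calc _ ≤ ENNReal.ofReal κ⁻¹ * (ENNReal.ofReal κ * totalVariation (u ∘ f) Ω') := by gcongr
    _ = totalVariation (u ∘ f) Ω' := by
      rw [← mul_assoc, ← ENNReal.ofReal_mul (by positivity), inv_mul_cancel₀ hκ0.ne']
      simp
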